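/- arXiv:1010.6036 — 2 statements merged into one kernel-verified Lean document; each statement's English description precedes it below -/
import Mathlib

section
/- For every finite graph G, twice its hypersphere number plus the reciprocal of the Lovász theta number of its complement equals 1, i.e., 2t(G) + 1/ϑ(Ḡ) = 1. -/
open scoped RealInnerProductSpace

def IsUnitDistRep {V : Type*} (G : SimpleGraph V) {d : ℕ}
    (u : V → EuclideanSpace ℝ (Fin d)) : Prop :=
  ∀ i j, G.Adj i j → ‖u i - u j‖ = 1

def IsHypersphereRep {V : Type*} (G : SimpleGraph V) {d : ℕ}
    (u : V → EuclideanSpace ℝ (Fin d)) (t : ℝ) : Prop :=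
  IsUnitDistRep G u ∧ ∀ i, ‖u i‖ ^ 2 = t

noncomputable def hypersphereNumber {V : Type*} (G : SimpleGraph V) : ℝ :=
  sInf {t | ∃ (d : ℕ) (u : V → EuclideanSpace ℝ (Fin d)), IsHypersphereRep G u t}

noncomputable def lovaszTheta {V : Type*} [Fintype V] (G : SimpleGraph V) : ℝ :=
  sSup {r | ∃ X : Matrix V V ℝ, X.PosSemidef ∧ X.trace = 1 ∧
    (∀ i j, G.Adj i j → X i j = 0) ∧ r = ∑ i, ∑ j, X i j}

lemma psd_iff {V : Type*} [Fintype V] (M : Matrix V V ℝ) :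
    M.PosSemidef ↔ (∀ i j, M i j = M j i) ∧ ∀ x : V → ℝ, 0 ≤ ∑ i, ∑ j, x i * M i j * x j := by
  rw [Matrix.posSemidef_iff_dotProduct_mulVec]
  refine and_congr ?_ (forall_congr' fun x => ?_)
  · rw [Matrix.IsHermitian.ext_iff]
    simp only [star_trivial]
    exact ⟨fun h i j => (h i j).symm, fun h i j => (h i j).symm⟩
  · simp [dotProduct, Matrix.mulVec, Finset.mul_sum, mul_assoc]

lemma weak_ineq {V : Type*} [Fintype V] (G : SimpleGraph V) {d : ℕ}
    (u : V → EuclideanSpace ℝ (Fin d)) (t : ℝ) (hu : IsHypersphereRep G u t)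
    (X : Matrix V V ℝ) (hX : X.PosSemidef) (htr : X.trace = 1)
    (h0 : ∀ i j, Gᶜ.Adj i j → X i j = 0) :
    0 ≤ (t - 1 / 2) * (∑ i, ∑ j, X i j) + 1 / 2 := by
  classical
  have hq := ((psd_iff X).1 hX).2
  have h1 : 0 ≤ ∑ k, ∑ i, ∑ j, u i k * X i j * u j k :=
    Finset.sum_nonneg fun k _ => hq fun i => u i k
  have h2 : ∑ k, ∑ i, ∑ j, u i k * X i j * u j k = ∑ i, ∑ j, X i j * ⟪u i, u j⟫ := by
    rw [Finset.sum_comm]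
    refine Finset.sum_congr rfl fun i _ => ?_
    rw [Finset.sum_comm]
    refine Finset.sum_congr rfl fun j _ => ?_
    rw [PiLp.inner_apply, Finset.mul_sum]
    refine Finset.sum_congr rfl fun k _ => ?_
    simp
    ring
  have h3 : ∀ i j, X i j * ⟪u i, u j⟫ = (t - 1 / 2) * X i j + (if i = j then X i j / 2 else 0) := by
    intro i j
    by_cases hij : i = j
    · subst hij
      rw [real_inner_self_eq_norm_sq, hu.2 i]
      simp
      ring
    · by_cases ha : G.Adj i j
      · have := norm_sub_sq_real (u i) (u j)
        rw [hu.1 i j ha, hu.2 i, hu.2 j] at this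
        have h4 : ⟪u i, u j⟫ = t - 1 / 2 := by linarith
        rw [h4]
        simp [hij]
        ring
      · have := h0 i j (by simp [hij, ha])
        simp [this]
  rw [h2] at h1
  simp_rw [h3, Finset.sum_add_distrib, ← Finset.mul_sum] at h1
  have h5 : ∑ i, ∑ j, (if i = j then X i j / 2 else 0) = 1 / 2 := by
    simp [← Finset.sum_div]
    have : ∑ i, X i i = 1 := htr
    rw [this]; norm_num
  linarith

lemma theta_bdd {V : Type*} [Fintype V] (G : SimpleGraph V) :
    BddAbove {r | ∃ X : Matrix V V ℝ, X.PosSemidef ∧ X.trace = 1 ∧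
    (∀ i j, G.Adj i j → X i j = 0) ∧ r = ∑ i, ∑ j, X i j} := by
  classical
  refine ⟨Fintype.card V, ?_⟩
  rintro r ⟨X, hX, htr, -, rfl⟩
  have htr' : ∑ i, X i i = 1 := htr
  obtain ⟨hs, hq⟩ := (psd_iff X).1 hX
  have h1 : ∀ i j, X i j ≤ X i i / 2 + X j j / 2 := by
    intro i j
    have := hq (fun k => (if k = i then 1 else 0) - (if k = j then 1 else 0))
    simp only [sub_mul, mul_sub, Finset.sum_sub_distrib, ite_mul, mul_ite, one_mul, mul_one,
      zero_mul, mul_zero, Finset.sum_ite_eq', Finset.mem_univ, if_true] at this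
    simp at this
    have := hs i j
    linarith
  calc ∑ i, ∑ j, X i j ≤ ∑ i, ∑ j, (X i i / 2 + X j j / 2) :=
        Finset.sum_le_sum fun i _ => Finset.sum_le_sum fun j _ => h1 i j
    _ = Fintype.card V := by
      simp only [Finset.sum_add_distrib, ← Finset.sum_div, htr', Finset.sum_const,
        Finset.card_univ, nsmul_eq_mul, ← Finset.mul_sum]
      ring

lemma one_mem {V : Type*} [Fintype V] [Nonempty V] (G : SimpleGraph V) :
    ∃ X : Matrix V V ℝ, X.PosSemidef ∧ X.trace = 1 ∧
    (∀ i j, G.Adj i j → X i j = 0) ∧ (1:ℝ) = ∑ i, ∑ j, X i j := by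
  classical
  obtain ⟨v⟩ := ‹Nonempty V›
  refine ⟨Matrix.diagonal (Pi.single v 1), ?_, ?_, ?_, ?_⟩
  · rw [Matrix.posSemidef_diagonal_iff]
    intro i
    by_cases h : i = v
    · subst h; simp
    · simp [h]
  · simp [Matrix.trace_diagonal]
  · intro i j h
    exact Matrix.diagonal_apply_ne _ h.ne
  · simp [Matrix.diagonal_apply]

lemma open_S {V : Type*} [Fintype V] :
    IsOpen {M : V → V → ℝ | ∀ x ∈ Metric.sphere (0 : V → ℝ) 1,
      0 < ∑ i, ∑ j, x i * M i j * x j} := by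
  rw [isOpen_iff_eventually]
  intro M hM
  refine (isCompact_sphere (0 : V → ℝ) 1).eventually_forall_of_forall_eventually ?_
  intro x hx
  have hc : Continuous fun p : (V → V → ℝ) × (V → ℝ) =>
      ∑ i, ∑ j, p.2 i * p.1 i j * p.2 j := by fun_prop
  exact hc.continuousAt.eventually (lt_mem_nhds (hM x hx))

lemma posdef_of_sphere {V : Type*} [Fintype V] {M : V → V → ℝ}
    (h : ∀ x ∈ Metric.sphere (0 : V → ℝ) 1, 0 < ∑ i, ∑ j, x i * M i j * x j) (x : V → ℝ) :
    0 ≤ ∑ i, ∑ j, x i * M i j * x j := by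
  by_cases hx : x = 0
  · subst hx; simp
  · have hn : 0 < ‖x‖ := norm_pos_iff.2 hx
    have := h (‖x‖⁻¹ • x) (by simp [norm_smul, hn.ne'])
    have h2 : ∑ i, ∑ j, x i * M i j * x j = ‖x‖ ^ 2 *
        ∑ i, ∑ j, (‖x‖⁻¹ • x) i * M i j * (‖x‖⁻¹ • x) j := by
      simp only [Finset.mul_sum, Pi.smul_apply, smul_eq_mul]
      refine Finset.sum_congr rfl fun i _ => Finset.sum_congr rfl fun j _ => ?_
      field_simp
    rw [h2]
    positivity

lemma mem_S {V : Type*} [Fintype V] [DecidableEq V] (v : V → ℝ) (e : ℝ) (he : 0 < e)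
    (x : V → ℝ) (hx : x ∈ Metric.sphere (0 : V → ℝ) 1) :
    0 < ∑ i, ∑ j, x i * (v i * v j + if i = j then e else 0) * x j := by
  have h1 : ∑ i, ∑ j, x i * (v i * v j + if i = j then e else 0) * x j
      = (∑ i, v i * x i) ^ 2 + e * ∑ i, x i ^ 2 := by
    simp only [mul_add, add_mul, Finset.sum_add_distrib, mul_ite, ite_mul, mul_zero, zero_mul,
      Finset.sum_ite_eq, Finset.mem_univ, if_true]
    rw [sq, Finset.sum_mul_sum, Finset.mul_sum]
    congr 1
    · exact Finset.sum_congr rfl fun i _ => Finset.sum_congr rfl fun j _ => by ring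
    · exact Finset.sum_congr rfl fun i _ => by ring
  rw [h1]
  have h2 : x ≠ 0 := by
    rintro rfl
    simp at hx
  obtain ⟨k, hk⟩ := Function.ne_iff.1 h2
  have h3 : 0 < ∑ i, x i ^ 2 :=
    Finset.sum_pos' (fun i _ => sq_nonneg _) ⟨k, Finset.mem_univ _, by
      have : x k ≠ 0 := hk
      positivity⟩
  positivity

lemma strong_dual {V : Type*} [Fintype V] [Nonempty V] (G : SimpleGraph V) (l : ℝ)
    (hl : lovaszTheta Gᶜ < l) :
    ∃ Z : Matrix V V ℝ, Z.PosSemidef ∧ (∀ i, Z i i = l - 1) ∧ ∀ i j, G.Adj i j → Z i j = -1 := by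
  classical
  set S := {M : V → V → ℝ | ∀ x ∈ Metric.sphere (0 : V → ℝ) 1,
      0 < ∑ i, ∑ j, x i * M i j * x j} with hS
  set A := {Z : V → V → ℝ | (∀ i, Z i i = l - 1) ∧ ∀ i j, G.Adj i j → Z i j = -1} with hA
  by_cases hd : Disjoint S A
  swap
  · obtain ⟨Z, hZS, hZA⟩ := Set.not_disjoint_iff.1 hd
    refine ⟨Matrix.of fun i j => (Z i j + Z j i) / 2, ?_, ?_, ?_⟩
    · rw [psd_iff]
      refine ⟨fun i j => by simp [add_comm], fun x => ?_⟩
      have h1 := posdef_of_sphere hZS x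
      have h2 : ∑ i, ∑ j, x i * Z j i * x j = ∑ i, ∑ j, x i * Z i j * x j := by
        rw [Finset.sum_comm]
        exact Finset.sum_congr rfl fun i _ => Finset.sum_congr rfl fun j _ => by ring
      have h3 : ∑ i, ∑ j, x i * ((Z i j + Z j i) / 2) * x j =
          (∑ i, ∑ j, x i * Z i j * x j + ∑ i, ∑ j, x i * Z j i * x j) / 2 := by
        simp only [← Finset.sum_add_distrib, Finset.sum_div]
        exact Finset.sum_congr rfl fun i _ => Finset.sum_congr rfl fun j _ => by ring
      simp only [Matrix.of_apply]
      rw [h3, h2]; linarith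
    · intro i
      simp [hZA.1 i]
    · intro i j h
      simp [hZA.2 i j h, hZA.2 j i h.symm]
  exfalso
  have hSc : Convex ℝ S := by
    rw [convex_iff_forall_pos]
    intro M hM N hN a b ha hb _ x hx
    have h1 := hM x hx
    have h2 := hN x hx
    have h3 : ∑ i, ∑ j, x i * (a • M + b • N) i j * x j =
        a * ∑ i, ∑ j, x i * M i j * x j + b * ∑ i, ∑ j, x i * N i j * x j := by
      simp only [Finset.mul_sum, ← Finset.sum_add_distrib, Pi.add_apply, Pi.smul_apply, smul_eq_mul]
      exact Finset.sum_congr rfl fun i _ => Finset.sum_congr rfl fun j _ => by ring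
    rw [h3]; positivity
  have hAc : Convex ℝ A := by
    intro M hM N hN a b _ _ hab
    refine ⟨fun i => ?_, fun i j h => ?_⟩
    · simp only [Pi.add_apply, Pi.smul_apply, smul_eq_mul, hM.1 i, hN.1 i]
      rw [← add_mul, hab, one_mul]
    · simp only [Pi.add_apply, Pi.smul_apply, smul_eq_mul, hM.2 i j h, hN.2 i j h]
      linarith
  obtain ⟨f, u, hfS, hfA⟩ := geometric_hahn_banach_open hSc open_S hAc hd
  have hcone : ∀ M ∈ S, ∀ a : ℝ, 0 < a → a • M ∈ S := by
    intro M hM a ha x hx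
    have h1 := hM x hx
    have h3 : ∑ i, ∑ j, x i * (a • M) i j * x j = a * ∑ i, ∑ j, x i * M i j * x j := by
      simp only [Finset.mul_sum, Pi.smul_apply, smul_eq_mul]
      exact Finset.sum_congr rfl fun i _ => Finset.sum_congr rfl fun j _ => by ring
    rw [h3]; positivity
  let R : V → ℝ → (V → ℝ) → (V → V → ℝ) := fun _ e v i j => v i * v j + if i = j then e else 0
  have hR : ∀ (w : V) e v, 0 < e → R w e v ∈ S := fun w e v he x hx => mem_S v e he x hx
  obtain ⟨w⟩ := ‹Nonempty V›
  -- f nonpositive on S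
  have hneg : ∀ M ∈ S, f M ≤ 0 := by
    intro M hM
    by_contra! h
    have := hfS _ (hcone M hM ((|u| + 1) / f M) (by positivity))
    rw [map_smul, smul_eq_mul, div_mul_cancel₀ _ h.ne'] at this
    linarith [le_abs_self u]
  have hu0 : 0 ≤ u := by
    by_contra! h
    have hM := hR w 1 0 one_pos
    have h1 := hneg _ hM
    have h2 := hfS _ (hcone _ hM ((-u) / (2 * (1 - f (R w 1 0)))) (by
      apply div_pos <;> linarith))
    rw [map_smul, smul_eq_mul, div_mul_eq_mul_div, div_lt_iff₀ (by linarith)] at h2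
    nlinarith
  -- coefficients
  let E : V → V → V → V → ℝ := fun i j => Pi.single i (Pi.single j 1)
  let c : V → V → ℝ := fun i j => f (E i j)
  have hf : ∀ M : V → V → ℝ, f M = ∑ i, ∑ j, c i j * M i j := by
    intro M
    have : M = ∑ i, ∑ j, M i j • E i j := by
      ext a b
      simp [E, Finset.sum_apply, Pi.single_apply, ite_apply]
    conv_lhs => rw [this]
    simp only [map_sum, map_smul, smul_eq_mul, c]
    exact Finset.sum_congr rfl fun i _ => Finset.sum_congr rfl fun j _ => mul_comm _ _
  let Z0 : V → V → ℝ := fun i j => (if i = j then l else 0) - 1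
  have hZ0 : Z0 ∈ A := ⟨fun i => by simp [Z0], fun i j h => by simp [Z0, h.ne]⟩
  have hc0 : ∀ i j, i ≠ j → ¬ G.Adj i j → c i j = 0 := by
    intro i j hij hna
    by_contra hc
    have hmem : ∀ a : ℝ, Z0 + a • E i j ∈ A := by
      intro a
      have hz : ∀ p q, (p ≠ i ∨ q ≠ j) → E i j p q = 0 := by
        intro p q h
        rcases eq_or_ne p i with rfl | hp
        · have hq : q ≠ j := by tauto
          simp [E, hq]
        · simp [E, hp]
      refine ⟨fun p => ?_, fun p q h => ?_⟩
      · have : E i j p p = 0 := hz p p (by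
          by_contra! h; exact hij (h.1.symm.trans h.2))
        simp [this, hZ0.1 p]
      · have : E i j p q = 0 := hz p q (by
          by_contra! h'; obtain ⟨rfl, rfl⟩ := h'; exact hna h)
        simp [this, hZ0.2 p q h]
    have := hfA _ (hmem ((u - 1 - f Z0) / c i j))
    rw [map_add, map_smul, smul_eq_mul] at this
    change u ≤ f Z0 + (u - 1 - f Z0) / c i j * c i j at this
    rw [div_mul_cancel₀ _ hc] at this
    linarith
  let X : Matrix V V ℝ := Matrix.of fun i j => -(c i j + c j i) / 2
  have hsw : ∀ x : V → ℝ, ∑ i, ∑ j, x i * X i j * x j = - ∑ i, ∑ j, c i j * (x i * x j) := by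
    intro x
    have h2 : ∑ i, ∑ j, c j i * (x i * x j) = ∑ i, ∑ j, c i j * (x i * x j) := by
      rw [Finset.sum_comm]
      exact Finset.sum_congr rfl fun i _ => Finset.sum_congr rfl fun j _ => by ring
    have h3 : ∑ i, ∑ j, x i * X i j * x j =
        -(∑ i, ∑ j, c i j * (x i * x j) + ∑ i, ∑ j, c j i * (x i * x j)) / 2 := by
      simp only [← Finset.sum_add_distrib, neg_div, Finset.sum_div, ← Finset.sum_neg_distrib]
      exact Finset.sum_congr rfl fun i _ => Finset.sum_congr rfl fun j _ => by simp [X]; ring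
    rw [h3, h2]; ring
  have hsum : ∑ i, ∑ j, X i j = - ∑ i, ∑ j, c i j := by
    simpa using hsw 1
  have htr : X.trace = - ∑ i, c i i := by
    simp only [Matrix.trace, Matrix.diag, ← Finset.sum_neg_distrib]
    exact Finset.sum_congr rfl fun i _ => by simp [X]
  have hfR : ∀ e v, f (R w e v) = ∑ i, ∑ j, c i j * (v i * v j) + e * ∑ i, c i i := by
    intro e v
    rw [hf]
    simp only [R, mul_add, Finset.sum_add_distrib, mul_ite, mul_zero, Finset.sum_ite_eq,
      Finset.mem_univ, if_true, Finset.mul_sum]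
    congr 1
    exact Finset.sum_congr rfl fun i _ => mul_comm _ _
  have hXpsd : X.PosSemidef := by
    rw [psd_iff]
    refine ⟨fun i j => by simp [X, add_comm], fun x => ?_⟩
    rw [hsw x]
    have h1 : ∀ e : ℝ, 0 < e → ∑ i, ∑ j, c i j * (x i * x j) + e * ∑ i, c i i ≤ 0 :=
      fun e he => hfR e x ▸ hneg _ (hR w e x he)
    by_contra! h
    set q := ∑ i, ∑ j, c i j * (x i * x j)
    set r := ∑ i, c i i
    have h2 := h1 (q / (2 * (1 + |r|))) (by
      apply div_pos
      · linarith
      · positivity)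
    have h3 : q / (2 * (1 + |r|)) * r ≥ - (q / 2) := by
      have hr : -(1 + |r|) ≤ r := by linarith [neg_abs_le r]
      have hp : 0 < 1 + |r| := by positivity
      rw [ge_iff_le, div_mul_eq_mul_div, le_div_iff₀ (by positivity)]
      nlinarith
    linarith
  have hfZ : f Z0 = l * (∑ i, c i i) - ∑ i, ∑ j, c i j := by
    rw [hf]
    simp only [Z0, mul_sub, Finset.sum_sub_distrib, mul_ite, mul_zero, Finset.sum_ite_eq,
      Finset.mem_univ, if_true, Finset.mul_sum, mul_one]
    congr 1
    exact Finset.sum_congr rfl fun i _ => mul_comm _ _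
  have hge := hfA _ hZ0
  have hI := hfS _ (hR w 1 0 one_pos)
  rw [hfR] at hI
  simp at hI
  have htr0 : 0 ≤ X.trace := hXpsd.trace_nonneg
  rcases htr0.eq_or_lt with h0 | hpos
  · have hX0 : X = 0 := hXpsd.trace_eq_zero_iff.1 h0.symm
    have hs0 : ∑ i, ∑ j, X i j = 0 := by simp [hX0]
    have : ∑ i, c i i = 0 := by linarith
    rw [this] at hfZ hI
    linarith
  · have hle : (X.trace)⁻¹ * ∑ i, ∑ j, X i j ≤ lovaszTheta Gᶜ := by
      refine le_csSup (theta_bdd Gᶜ) ⟨(X.trace)⁻¹ • X, hXpsd.smul (by positivity), ?_, ?_, ?_⟩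
      · simp [hpos.ne']
      · intro i j h
        rw [SimpleGraph.compl_adj] at h
        have h1 := hc0 i j h.1 h.2
        have h2 := hc0 j i h.1.symm (fun h' => h.2 h'.symm)
        simp [X, h1, h2]
      · simp [Finset.mul_sum]
    have h4 : l ≤ (X.trace)⁻¹ * ∑ i, ∑ j, X i j := by
      rw [inv_mul_eq_div, le_div_iff₀ hpos]
      rw [htr, hsum]
      linarith
    linarith

open scoped MatrixOrder Matrix.Norms.L2Operator in
lemma exists_rep {V : Type*} [Fintype V] (G : SimpleGraph V) (l : ℝ) (hl : 0 < l)
    (Z : Matrix V V ℝ) (hZ : Z.PosSemidef) (hd : ∀ i, Z i i = l - 1)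
    (he : ∀ i j, G.Adj i j → Z i j = -1) :
    ∃ (d : ℕ) (u : V → EuclideanSpace ℝ (Fin d)), IsHypersphereRep G u ((1 - 1 / l) / 2) := by
  classical
  have hP : ((2 * l)⁻¹ • Z).PosSemidef := hZ.smul (by positivity)
  obtain ⟨B, hB⟩ : ∃ B : Matrix V V ℝ, (2 * l)⁻¹ • Z = B.conjTranspose * B := by
    obtain ⟨B, hB⟩ := CStarAlgebra.nonneg_iff_eq_star_mul_self.mp hP.nonneg
    exact ⟨B, hB⟩
  let e := Fintype.equivFin V
  let u : V → EuclideanSpace ℝ (Fin (Fintype.card V)) :=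
    fun i => WithLp.toLp 2 fun k => B (e.symm k) i
  have hin : ∀ i j, ⟪u i, u j⟫ = (2 * l)⁻¹ * Z i j := by
    intro i j
    have h1 : (2 * l)⁻¹ * Z i j = ∑ k, B k i * B k j := by
      have := congrFun (congrFun hB i) j
      simpa [Matrix.mul_apply] using this
    rw [h1, PiLp.inner_apply, ← e.symm.sum_comp]
    refine Finset.sum_congr rfl fun k _ => ?_
    simp [u, mul_comm]
  have hn : ∀ i, ‖u i‖ ^ 2 = (1 - 1 / l) / 2 := by
    intro i
    rw [← real_inner_self_eq_norm_sq, hin, hd]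
    field_simp
  refine ⟨_, u, fun i j h => ?_, hn⟩
  have h1 := norm_sub_sq_real (u i) (u j)
  rw [hn, hn, hin, he i j h] at h1
  have h2 : ‖u i - u j‖ ^ 2 = 1 := by
    rw [h1]; field_simp; ring
  nlinarith [norm_nonneg (u i - u j)]

theorem hypersphere_theta_relation {V : Type*} [Fintype V] [Nonempty V]
    (G : SimpleGraph V) :
    2 * hypersphereNumber G + 1 / lovaszTheta Gᶜ = 1 := by
  have h1 : 1 ≤ lovaszTheta Gᶜ := le_csSup (theta_bdd Gᶜ) (one_mem Gᶜ)
  set θ := lovaszTheta Gᶜ with hθ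
  have hlow : ∀ t ∈ {t | ∃ (d : ℕ) (u : V → EuclideanSpace ℝ (Fin d)), IsHypersphereRep G u t},
      (1 - 1 / θ) / 2 ≤ t := by
    rintro t ⟨d, u, hu⟩
    by_contra! hlt
    have hθ' : 1 / θ < 1 - 2 * t := by linarith
    have hp : 0 < 1 - 2 * t := lt_trans (by positivity) hθ'
    have : θ ≤ 1 / (1 - 2 * t) := by
      refine csSup_le ⟨1, one_mem Gᶜ⟩ ?_
      rintro r ⟨X, hX, htr, h0, rfl⟩
      have := weak_ineq G u t hu X hX htr h0
      rw [le_div_iff₀ hp]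
      linarith
    rw [le_div_iff₀ hp] at this
    rw [div_lt_iff₀ (by linarith)] at hθ'
    linarith
  have hup : ∀ l, θ < l → hypersphereNumber G ≤ (1 - 1 / l) / 2 := by
    intro l hl
    obtain ⟨Z, hZ, hd, he⟩ := strong_dual G l hl
    exact csInf_le ⟨_, hlow⟩ (exists_rep G l (by linarith) Z hZ hd he)
  have hge : (1 - 1 / θ) / 2 ≤ hypersphereNumber G := by
    obtain ⟨Z, hZ, hd, he⟩ := strong_dual G (θ + 1) (by linarith)
    exact le_csInf ⟨_, exists_rep G (θ + 1) (by linarith) Z hZ hd he⟩ hlow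
  have hle : 1 / θ ≤ 1 - 2 * hypersphereNumber G := by
    set T := hypersphereNumber G
    have hp : 0 < 1 - 2 * T := by
      have := hup (θ + 1) (by linarith)
      have h3 : 0 < 1 / (θ + 1) := by positivity
      linarith
    have : 1 / (1 - 2 * T) ≤ θ := by
      refine le_of_forall_gt_imp_ge_of_dense fun l hl => ?_
      have := hup l hl
      have h3 : 1 / l ≤ 1 - 2 * T := by linarith
      rw [div_le_iff₀ (by linarith)] at h3
      rw [div_le_iff₀ hp]
      linarith
    rw [div_le_iff₀ hp] at this
    rw [div_le_iff₀ (by linarith)]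
    linarith
  linarith
end

section
/- Let G = G₁ ∪ G₂ with G₁ ∩ G₂ a complete graph. For i ∈ {1,2}, if Gᵢ has a unit-distance representation contained in a Euclidean ball of radius rᵢ, then G has a unit-distance representation contained in a Euclidean ball of radius max{r₁, r₂}. -/
open scoped RealInnerProductSpace

lemma aux_factor {V : Type*} [Fintype V] [DecidableEq V] (A : Matrix V V ℝ)
    (hA : A.PosSemidef) : ∃ B : Matrix V V ℝ, ∀ i j, A i j = ∑ k, B k i * B k j := by
  open scoped MatrixOrder Matrix.Norms.L2Operator in
  obtain ⟨B, rfl⟩ := CStarAlgebra.nonneg_iff_eq_star_mul_self.mp hA.nonneg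
  exact ⟨B, fun i j => by simp [Matrix.mul_apply, Matrix.star_eq_conjTranspose]⟩

lemma aux_unitdiag {V : Type*} [Fintype V] [DecidableEq V] (G : SimpleGraph V) {d : ℕ}
    (x : V → EuclideanSpace ℝ (Fin d)) (s : ℝ) (hs : 0 < s)
    (hx : ∀ i j, G.Adj i j → ‖x i - x j‖ = 1)
    (hb : ∀ i, s ≤ 1/2 - ‖x i‖^2)
    (Z : Matrix V V ℝ) (hsym : ∀ i j, Z i j = Z j i)
    (hdiag : ∀ i, Z i i = 1) (hsupp : ∀ i j, i ≠ j → ¬ G.Adj i j → Z i j = 0)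
    (hpsd : ∀ y : V → ℝ, 0 ≤ ∑ i, ∑ j, Z i j * (y i * y j)) (e : V → ℝ) :
    s * ∑ i, ∑ j, Z i j * (e i * e j) ≤ (1/2) * ∑ i, e i ^ 2 := by
  classical
  let W : Matrix V V ℝ := (1/2 : ℝ) • (1 : Matrix V V ℝ) - s • Z
  have hW : W.IsHermitian := by
    ext i j
    simp [W, Matrix.conjTranspose_apply, Matrix.one_apply, hsym i j, eq_comm]
  have hWps : W.PosSemidef := by
    rw [hW.posSemidef_iff_eigenvalues_nonneg]
    intro k
    set μ := hW.eigenvalues k with hμ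
    let v : V → ℝ := (hW.eigenvectorBasis k).ofLp
    have hv : W.mulVec v = μ • v := hW.mulVec_eigenvectorBasis k
    have hv1 : ∑ i, v i ^ 2 = 1 := by
      have h := hW.eigenvectorBasis.orthonormal.1 k
      have h2 := EuclideanSpace.real_norm_sq_eq (hW.eigenvectorBasis k)
      rw [h] at h2
      simpa [v] using h2.symm
    have hZv : ∀ i, s * ∑ j, Z i j * v j = (1/2 - μ) * v i := by
      intro i
      have h := congrFun hv i
      simp only [W, Matrix.sub_mulVec, Matrix.smul_mulVec, Matrix.one_mulVec, Pi.sub_apply,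
        Pi.smul_apply, smul_eq_mul] at h
      have h3 : (Z.mulVec v) i = ∑ j, Z i j * v j := rfl
      rw [h3] at h
      linarith
    have hent : ∀ i j, Z i j * inner ℝ (x i) (x j) =
        Z i j * ((if i = j then 1/2 else 0) - ((1/2 - ‖x i‖^2) + (1/2 - ‖x j‖^2))/2) := by
      intro i j
      by_cases hij : i = j
      · subst hij
        rw [real_inner_self_eq_norm_sq]; simp
      · by_cases ha : G.Adj i j
        · have h := norm_sub_sq_real (x i) (x j)
          rw [hx i j ha] at h
          rw [if_neg hij]
          congr 1
          linarith
        · rw [hsupp i j hij ha]; simp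
    have hnn : 0 ≤ ∑ i, ∑ j, Z i j * inner ℝ (x i) (x j) * (v i * v j) := by
      have : ∑ i, ∑ j, Z i j * inner ℝ (x i) (x j) * (v i * v j) =
          ∑ l, ∑ i, ∑ j, Z i j * ((v i * x i l) * (v j * x j l)) := by
        rw [Finset.sum_comm (s := (Finset.univ : Finset (Fin d)))]
        refine Finset.sum_congr rfl fun i _ => ?_
        rw [Finset.sum_comm (s := (Finset.univ : Finset (Fin d)))]
        refine Finset.sum_congr rfl fun j _ => ?_
        rw [PiLp.inner_apply, Finset.mul_sum, Finset.sum_mul]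
        refine Finset.sum_congr rfl fun l _ => ?_
        simp
        ring
      rw [this]
      exact Finset.sum_nonneg fun l _ => hpsd _
    have heq : s * ∑ i, ∑ j, Z i j * inner ℝ (x i) (x j) * (v i * v j) =
        ∑ i, v i ^ 2 * (s / 2 - (1/2 - μ) * (1/2 - ‖x i‖^2)) := by
      have h1 : ∑ i, ∑ j, Z i j * inner ℝ (x i) (x j) * (v i * v j) =
        ∑ i, v i ^2 * (1/2) - ∑ i, (1/2 - ‖x i‖^2) * v i * ∑ j, Z i j * v j := by
        have hA : ∑ i, ∑ j, Z i j * inner ℝ (x i) (x j) * (v i * v j) =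
          ∑ i, ∑ j, (if i = j then Z i j * (v i * v j) * (1/2) else 0) 
          - (1/2) * ∑ i, ∑ j, (1/2 - ‖x i‖^2) * v i * (Z i j * v j)
          - (1/2) * ∑ i, ∑ j, (1/2 - ‖x j‖^2) * v j * (Z j i * v i) := by
          simp only [Finset.mul_sum, ← Finset.sum_sub_distrib]
          refine Finset.sum_congr rfl fun i _ => Finset.sum_congr rfl fun j _ => ?_
          rw [hent, hsym j i]
          split_ifs <;> ring
        have hB : ∑ i, ∑ j, (1/2 - ‖x j‖^2) * v j * (Z j i * v i) =
          ∑ i, ∑ j, (1/2 - ‖x i‖^2) * v i * (Z i j * v j) := Finset.sum_comm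
        rw [hA, hB]
        simp only [Finset.sum_ite_eq, Finset.mem_univ, if_true, hdiag, Finset.mul_sum]
        simp only [← Finset.mul_sum, ← pow_two, one_mul]
        ring
      rw [h1, mul_sub, Finset.mul_sum, Finset.mul_sum, ← Finset.sum_sub_distrib]
      refine Finset.sum_congr rfl fun i _ => ?_
      linear_combination (-(1/2 - ‖x i‖^2) * v i) * hZv i
    by_contra hneg
    push Not at hneg
    have hneg' : μ < 0 := by simpa using hneg
    have hlt : ∑ i, v i ^ 2 * (s / 2 - (1/2 - μ) * (1/2 - ‖x i‖^2)) ≤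
        ∑ i, v i ^ 2 * (μ * s) := by
      refine Finset.sum_le_sum fun i _ => ?_
      refine mul_le_mul_of_nonneg_left ?_ (sq_nonneg _)
      nlinarith [hb i]
    rw [← Finset.sum_mul, hv1, ← heq] at hlt
    nlinarith [mul_nonneg hs.le hnn, mul_pos hs (neg_pos.2 hneg')]
  have h := hWps.dotProduct_mulVec_nonneg e
  simp only [W, Matrix.sub_mulVec, Matrix.smul_mulVec, Matrix.one_mulVec, dotProduct_sub,
    dotProduct_smul, smul_eq_mul, star_trivial] at h
  have h3 : e ⬝ᵥ Z.mulVec e = ∑ i, ∑ j, Z i j * (e i * e j) := by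
    simp only [dotProduct, Matrix.mulVec, Finset.mul_sum]
    exact Finset.sum_congr rfl fun i _ => Finset.sum_congr rfl fun j _ => by ring
  have h4 : e ⬝ᵥ e = ∑ i, e i ^ 2 := by simp [dotProduct, pow_two]
  rw [h3, h4] at h
  linarith

lemma aux_dual {V : Type*} [Fintype V] [DecidableEq V] (G : SimpleGraph V) {d : ℕ}
    (x : V → EuclideanSpace ℝ (Fin d)) (s : ℝ) (hs : 0 < s)
    (hx : ∀ i j, G.Adj i j → ‖x i - x j‖ = 1)
    (hb : ∀ i, s ≤ 1/2 - ‖x i‖^2)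
    (Y : Matrix V V ℝ) (hsym : ∀ i j, Y i j = Y j i)
    (hdiag : ∀ i, 0 < Y i i) (hsupp : ∀ i j, i ≠ j → ¬ G.Adj i j → Y i j = 0)
    (hpsd : ∀ y : V → ℝ, 0 ≤ ∑ i, ∑ j, Y i j * (y i * y j)) :
    s * ∑ i, ∑ j, Y i j ≤ (1/2) * ∑ i, Y i i := by
  have hq : ∀ i, 0 < √(Y i i) := fun i => Real.sqrt_pos.2 (hdiag i)
  have h := aux_unitdiag G x s hs hx hb (fun i j => Y i j / (√(Y i i) * √(Y j j)))
    (fun i j => by rw [hsym i j, mul_comm]) 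
    (fun i => by rw [Real.mul_self_sqrt (hdiag i).le]; exact div_self (hdiag i).ne')
    (fun i j h1 h2 => by simp [hsupp i j h1 h2])
    (fun y => by
      refine (hpsd (fun i => y i / √(Y i i))).trans_eq ?_
      refine Finset.sum_congr rfl fun i _ => Finset.sum_congr rfl fun j _ => ?_
      have := hq i; have := hq j
      field_simp)
    (fun i => √(Y i i))
  have e1 : ∀ i j, Y i j / (√(Y i i) * √(Y j j)) * (√(Y i i) * √(Y j j)) = Y i j := fun i j =>
    div_mul_cancel₀ _ (mul_pos (hq i) (hq j)).ne'
  simpa only [e1, Real.sq_sqrt (hdiag _).le] using h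

lemma aux_hyper {V : Type*} [Fintype V] [Nonempty V] (G : SimpleGraph V) {d : ℕ}
    (x : V → EuclideanSpace ℝ (Fin d)) (r : ℝ) (hr : 0 ≤ r) (hr2 : r^2 < 1/2)
    (hx : ∀ i j, G.Adj i j → ‖x i - x j‖ = 1)
    (hb : ∀ i, ‖x i‖ ≤ r) :
    ∃ w : V → EuclideanSpace ℝ V, (∀ i, inner ℝ (w i) (w i) = r^2) ∧
      ∀ i j, G.Adj i j → inner ℝ (w i) (w j) = r^2 - 1/2 := by
  classical
  rcases hr.eq_or_lt with h0 | hpos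
  · subst h0
    refine ⟨0, by simp, fun i j h => ?_⟩
    have h1 : x i = 0 := norm_le_zero_iff.1 (hb i)
    have h2 : x j = 0 := norm_le_zero_iff.1 (hb j)
    have := hx i j h
    simp [h1, h2] at this
  let p : V → V → Prop := fun i j => i = j ∨ G.Adj i j
  let b : V → V → ℝ := fun i j => if i = j then r^2 else if G.Adj i j then r^2 - 1/2 else 0
  -- it suffices to find a PSD completion
  suffices hmain : ∃ A : Matrix V V ℝ, A.PosSemidef ∧ ∀ i j, p i j → A i j = b i j by
    obtain ⟨A, hA, hAb⟩ := hmain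
    obtain ⟨B, hB⟩ := aux_factor A hA
    have hin : ∀ i j, inner ℝ (WithLp.toLp 2 (fun k => B k i) : EuclideanSpace ℝ V)
        (WithLp.toLp 2 (fun k => B k j)) = A i j := by
      intro i j
      simp [PiLp.inner_apply, hB, mul_comm]
    refine ⟨fun i => WithLp.toLp 2 (fun k => B k i), fun i => ?_, fun i j h => ?_⟩
    · rw [hin, hAb i i (Or.inl rfl)]; simp [b]
    · rw [hin, hAb i j (Or.inr h)]; simp [b, h.ne, h]
  by_contra hno
  let P : (V → ℝ) → (V → V → ℝ) := fun x i j => if p i j then x i * x j else 0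
  let M : (V → V → ℝ) → (V → V → ℝ) := fun B i j => if p i j then ∑ k, B k i * B k j else 0
  let Q : Set (V → V → ℝ) := {C | ∃ A : Matrix V V ℝ, A.PosSemidef ∧ A.trace = 1 ∧
      ∀ i j, C i j = if p i j then A i j else 0}
  have hcomp : IsCompact {B : V → V → ℝ | ∑ i, ∑ k, B k i ^ 2 = 1} := by
    refine Metric.isCompact_of_isClosed_isBounded ?_ ?_
    · exact isClosed_eq (by fun_prop) (by fun_prop)
    · refine (Metric.isBounded_closedBall (x := (0 : V → V → ℝ)) (r := 1)).subset ?_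
      intro B hB
      rw [mem_closedBall_zero_iff, pi_norm_le_iff_of_nonneg zero_le_one]
      intro k
      rw [pi_norm_le_iff_of_nonneg zero_le_one]
      intro i
      have h1 : B k i ^ 2 ≤ ∑ k, B k i ^ 2 :=
        Finset.single_le_sum (f := fun k => B k i ^ 2) (fun i _ => sq_nonneg _)
          (Finset.mem_univ k)
      have h2 : ∑ k, B k i ^ 2 ≤ ∑ i, ∑ k, B k i ^ 2 :=
        Finset.single_le_sum (f := fun i => ∑ k, B k i ^ 2)
          (fun i _ => Finset.sum_nonneg fun _ _ => sq_nonneg _) (Finset.mem_univ i)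
      have h3 : ∑ i, ∑ k, B k i ^ 2 = 1 := hB
      rw [Real.norm_eq_abs]
      exact (sq_le_one_iff_abs_le_one _).1 (by linarith)
  have hM : Continuous M := by
    refine continuous_pi fun i => continuous_pi fun j => ?_
    by_cases h : p i j
    · simp only [M, h, if_true]; fun_prop
    · simp only [M, h, if_false]; fun_prop
  have hQM : M '' {B : V → V → ℝ | ∑ i, ∑ k, B k i ^ 2 = 1} = Q := by
    ext C
    constructor
    · rintro ⟨B, hB, rfl⟩
      have hB' : ∑ i, ∑ k, B k i ^ 2 = 1 := hB
      refine ⟨(Matrix.of B).conjTranspose * Matrix.of B,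
        Matrix.posSemidef_conjTranspose_mul_self _, ?_, fun i j => ?_⟩
      · rw [← hB']
        simp [Matrix.trace, Matrix.mul_apply, pow_two]
      · simp [M, Matrix.mul_apply]
    · rintro ⟨A, hA, htr, hC⟩
      obtain ⟨B, hB⟩ := aux_factor A hA
      refine ⟨B, ?_, ?_⟩
      · change ∑ i, ∑ k, B k i ^ 2 = 1
        rw [← htr]
        simp [Matrix.trace, hB, pow_two]
      · ext i j
        rw [hC i j, hB i j]
  have hQ : IsCompact Q := hQM ▸ hcomp.image hM
  have hQP : ∀ y : V → ℝ, ∑ i, y i ^ 2 = 1 → P y ∈ Q := by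
    intro y hy
    refine ⟨Matrix.vecMulVec y y, ?_, ?_, ?_⟩
    · simpa using Matrix.posSemidef_vecMulVec_self_star y
    · simpa [Matrix.trace, Matrix.vecMulVec_apply, pow_two] using hy
    · intro i j
      simp [P, Matrix.vecMulVec_apply]
  have hQc : Convex ℝ Q := by
    rintro B₁ ⟨A₁, h1, h2, h3⟩ B₂ ⟨A₂, k1, k2, k3⟩ a c ha hc hac
    refine ⟨a • A₁ + c • A₂, (h1.smul ha).add (k1.smul hc), ?_, ?_⟩
    · simp [Matrix.trace_add, Matrix.trace_smul, h2, k2, hac]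
    · intro i j
      simp only [Pi.add_apply, Pi.smul_apply, h3, k3, Matrix.add_apply, Matrix.smul_apply]
      split_ifs <;> simp
  let R : Set (V → V → ℝ) := (fun t : ℝ => t • b) '' Set.Ici 0
  have hbne : b ≠ 0 := by
    intro h
    have i := Classical.arbitrary V
    have := congrFun (congrFun h i) i
    simp [b] at this
    exact hpos.ne' this
  have hRc : Convex ℝ R := by
    have := (convex_Ici (𝕜 := ℝ) (0:ℝ)).is_linear_image (f := fun t : ℝ => t • b)
      (LinearMap.toSpanSingleton ℝ (V → V → ℝ) b).isLinear
    exact this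
  have hRcl : IsClosed R :=
    (isClosedEmbedding_smul_left hbne).isClosedMap _ isClosed_Ici
  have hdisj : Disjoint Q R := by
    rw [Set.disjoint_left]
    rintro _ hB ⟨t, ht, rfl⟩
    obtain ⟨A, hA, htr, hAb'⟩ := hB
    have hAb : ∀ i j, p i j → A i j = (t • b) i j := fun i j h => by
      have := hAb' i j
      rw [if_pos h] at this
      exact this.symm
    have ht0 : t ≠ 0 := by
      rintro rfl
      have : A.trace = 0 := by
        refine Finset.sum_eq_zero fun i _ => ?_
        have := hAb i i (Or.inl rfl)
        simpa using this
      linarith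
    refine hno ⟨t⁻¹ • A, hA.smul (inv_nonneg.2 ht), fun i j h => ?_⟩
    have := hAb i j h
    simp only [Pi.smul_apply, smul_eq_mul] at this
    simp [this, ht0]
  obtain ⟨f, u, v, hfu, huv, hfv⟩ :=
    geometric_hahn_banach_closed_compact hRc hRcl hQc hQ hdisj.symm
  have hu0 : 0 < u := by
    have := hfu 0 ⟨0, Set.mem_Ici.2 le_rfl, by simp⟩
    simpa using this
  have hfb : f b ≤ 0 := by
    by_contra hc
    push Not at hc
    have := hfu ((u / f b) • b) ⟨u / f b, Set.mem_Ici.2 (by positivity), rfl⟩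
    rw [map_smul, smul_eq_mul, div_mul_cancel₀ _ hc.ne'] at this
    exact lt_irrefl _ this
  -- coordinates of f
  let F : V → V → ℝ := fun i j => f (Pi.single i (Pi.single j 1))
  have hF : ∀ B : V → V → ℝ, f B = ∑ i, ∑ j, F i j * B i j := by
    intro B
    have hB : B = ∑ i, ∑ j, B i j • (Pi.single i (Pi.single j 1) : V → V → ℝ) := by
      ext i j
      simp [Finset.sum_apply, Pi.single_apply, apply_ite, ite_apply]
    conv_lhs => rw [hB]
    simp only [map_sum, map_smul, smul_eq_mul, F, mul_comm]
  let Y : Matrix V V ℝ := fun i j =>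
    (if p i j then (F i j + F j i) / 2 else 0) - (if i = j then u / 2 else 0)
  have hps : ∀ i j, p i j ↔ p j i := fun i j => by simp only [p, eq_comm, G.adj_comm]
  have hsymm : ∀ B : V → V → ℝ, (∀ i j, B i j = B j i) → (∀ i j, ¬ p i j → B i j = 0) →
      ∑ i, ∑ j, Y i j * B i j = f B - u / 2 * ∑ i, B i i := by
    intro B h1 h2
    have e1 : ∑ i, ∑ j, Y i j * B i j = (1/2) * ∑ i, ∑ j, F i j * B i j
        + (1/2) * ∑ i, ∑ j, F j i * B j i
        - ∑ i, ∑ j, (if i = j then u / 2 * B i j else 0) := by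
      simp only [Finset.mul_sum, ← Finset.sum_sub_distrib, ← Finset.sum_add_distrib]
      refine Finset.sum_congr rfl fun i _ => Finset.sum_congr rfl fun j _ => ?_
      rw [h1 j i]
      by_cases h : p i j
      · simp only [Y, h, if_true]; split_ifs <;> ring
      · simp only [h2 i j h]; split_ifs <;> ring
    rw [e1, Finset.sum_comm (f := fun i j => F j i * B j i), ← hF]
    simp only [Finset.sum_ite_eq, Finset.mem_univ, if_true, ← Finset.mul_sum]
    ring
  have hYsupp : ∀ i j, ¬ p i j → Y i j = 0 := by
    intro i j h
    have : i ≠ j := fun h' => h (Or.inl h')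
    simp [Y, h, this]
  have hYP : ∀ y : V → ℝ, ∑ i, ∑ j, Y i j * (y i * y j) = f (P y) - u / 2 * ∑ i, y i ^ 2 := by
    intro y
    have := hsymm (P y) (fun i j => by simp only [P, hps i j, mul_comm]) 
      (fun i j h => by simp [P, h])
    have h2 : ∀ i, P y i i = y i ^ 2 := fun i => by simp [P, p, pow_two]
    simp only [h2] at this
    rw [← this]
    refine Finset.sum_congr rfl fun i _ => Finset.sum_congr rfl fun j _ => ?_
    by_cases h : p i j
    · simp [P, h]
    · simp [hYsupp i j h]
  have hlow : ∀ y : V → ℝ, u / 2 * ∑ i, y i ^ 2 ≤ ∑ i, ∑ j, Y i j * (y i * y j) := by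
    intro y
    set n := ∑ i, y i ^ 2 with hn
    have hn0 : 0 ≤ n := Finset.sum_nonneg fun i _ => sq_nonneg _
    rcases hn0.eq_or_lt with h | h
    · have hy : ∀ i, y i = 0 := by
        intro i
        have := (Finset.sum_eq_zero_iff_of_nonneg (fun i _ => sq_nonneg (y i))).1 h.symm i
          (Finset.mem_univ i)
        exact pow_eq_zero_iff (two_ne_zero) |>.1 this
      simp [← h, hy]
    · rw [hYP y, ← hn]
      have hz : P (fun i => y i / √n) ∈ Q := by
        refine hQP _ ?_
        simp only [div_pow, Real.sq_sqrt hn0, ← Finset.sum_div]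
        exact div_self h.ne'
      have hz2 := hfv _ hz
      have hz3 : P y = n • P (fun i => y i / √n) := by
        ext i j
        simp only [P, Pi.smul_apply, smul_eq_mul]
        split_ifs
        · rw [div_mul_div_comm, Real.mul_self_sqrt hn0]; field_simp
        · simp
      rw [hz3, map_smul, smul_eq_mul]
      nlinarith
  have hd := aux_dual G x (1/2 - r^2) (by linarith) hx
    (fun i => by have := pow_le_pow_left₀ (norm_nonneg _) (hb i) 2; linarith) Y
    (fun i j => by simp only [Y, hps i j, add_comm (F i j), eq_comm (a := i)])
    (fun i => by
      have := hlow (Pi.single i 1)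
      simp [Pi.single_apply] at this
      linarith)
    (fun i j h1 h2 => hYsupp i j (by simp [p, h1, h2]))
    (fun y => le_trans (by positivity) (hlow y))
  have hfin := hsymm b (fun i j => by simp only [b, G.adj_comm, eq_comm])
    (fun i j h => by
      simp only [p, not_or] at h
      simp [b, h.1, h.2])
  have hYb : ∑ i, ∑ j, Y i j * b i j = (1/2) * ∑ i, Y i i - (1/2 - r^2) * ∑ i, ∑ j, Y i j := by
    have : ∀ i j, Y i j * b i j = (if i = j then (1/2) * Y i j else 0) - (1/2 - r^2) * Y i j := by
      intro i j
      by_cases h : i = j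
      · simp only [b, h, if_true]; ring
      · by_cases h' : G.Adj i j
        · simp only [b, h, h', if_true, if_false]; ring
        · rw [hYsupp i j (by simp [p, h, h'])]; simp
    simp only [this, Finset.sum_sub_distrib, Finset.sum_ite_eq, Finset.mem_univ, if_true,
      Finset.mul_sum]
  rw [hYb] at hfin
  have hbpos : 0 < ∑ i, b i i :=
    Finset.sum_pos (fun i _ => by simp only [b, if_true]; positivity) Finset.univ_nonempty
  nlinarith [mul_pos hu0 hbpos]

lemma aux_glue {V : Type*} [Fintype V] {E : Type*} [NormedAddCommGroup E] [InnerProductSpace ℝ E]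
    [FiniteDimensional ℝ E] (K : Set V) (a b : V → E)
    (h : ∀ i ∈ K, ∀ j ∈ K, inner ℝ (a i) (a j) = inner ℝ (b i) (b j)) :
    ∃ L : E →ₗᵢ[ℝ] E, ∀ i ∈ K, L (a i) = b i := by
  classical
  let Φ : (V → E) → ((K → ℝ) →ₗ[ℝ] E) := fun a => Fintype.linearCombination ℝ (fun k : K => a k)
  have hn : ∀ y, ‖Φ a y‖ = ‖Φ b y‖ := by
    intro y
    have : ‖Φ a y‖ ^ 2 = ‖Φ b y‖ ^ 2 := by
      rw [← real_inner_self_eq_norm_sq, ← real_inner_self_eq_norm_sq]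
      simp only [Φ, Fintype.linearCombination_apply, sum_inner, inner_sum, inner_smul_left,
        inner_smul_right, Finset.mul_sum]
      refine Finset.sum_congr rfl fun i _ => Finset.sum_congr rfl fun j _ => ?_
      rw [h _ j.2 _ i.2]
    exact (sq_eq_sq₀ (norm_nonneg _) (norm_nonneg _)).1 this
  have hker : LinearMap.ker (Φ a) ≤ LinearMap.ker (Φ b) := by
    intro y hy
    rw [LinearMap.mem_ker] at hy ⊢
    rw [← norm_eq_zero, ← hn, hy, norm_zero]
  let L0 : LinearMap.range (Φ a) →ₗ[ℝ] E :=
    ((LinearMap.ker (Φ a)).liftQ (Φ b) hker) ∘ₗ (Φ a).quotKerEquivRange.symm.toLinearMap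
  have hL0 : ∀ y, L0 ⟨Φ a y, LinearMap.mem_range_self _ y⟩ = Φ b y := by
    intro y
    have : (Φ a).quotKerEquivRange.symm ⟨Φ a y, LinearMap.mem_range_self _ y⟩
        = (LinearMap.ker (Φ a)).mkQ y := (Φ a).quotKerEquivRange_symm_apply_image y _
    simp only [L0, LinearMap.comp_apply, LinearEquiv.coe_coe, this]
    simp
  let L1 : LinearMap.range (Φ a) →ₗᵢ[ℝ] E := ⟨L0, by
    rintro ⟨_, y, rfl⟩
    rw [hL0]
    exact (hn y).symm⟩
  refine ⟨L1.extend, fun i hi => ?_⟩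
  have ha : ∀ a : V → E, Φ a (Pi.single ⟨i, hi⟩ 1) = a i := by
    intro a
    simp [Φ, Fintype.linearCombination_apply_single]
  have h1 := L1.extend_apply ⟨Φ a (Pi.single ⟨i, hi⟩ 1), LinearMap.mem_range_self _ _⟩
  have h2 := hL0 (Pi.single ⟨i, hi⟩ 1)
  change _ = L0 _ at h1
  rw [h2, ha b] at h1
  simp only [ha a] at h1
  exact h1

lemma aux_transfer {V : Type*} [Fintype V] (G : SimpleGraph V) (r : ℝ)
    (w : V → EuclideanSpace ℝ V) (hw : ∀ i j, G.Adj i j → ‖w i - w j‖ = 1)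
    (hb : ∀ i, ‖w i‖ ≤ r) :
    ∃ (d : ℕ) (u : V → EuclideanSpace ℝ (Fin d)) (c : EuclideanSpace ℝ (Fin d)),
      IsUnitDistRep G u ∧ ∀ i, ‖u i - c‖ ≤ r := by
  let φ := (stdOrthonormalBasis ℝ (EuclideanSpace ℝ V)).repr
  refine ⟨_, fun i => φ (w i), 0, fun i j h => ?_, fun i => ?_⟩
  · rw [← map_sub, LinearIsometryEquiv.norm_map]; exact hw i j h
  · rw [sub_zero, LinearIsometryEquiv.norm_map]; exact hb i

/-- Clique sums and balls: if each `Gᵢ` has a unit-distance representation contained in a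
Euclidean ball of radius `rᵢ`, then `G = G₁ ∪ G₂` (with `G₁ ∩ G₂` complete) has a
unit-distance representation contained in a Euclidean ball of radius `max r₁ r₂`. -/
theorem unitDistRep_in_ball_cliqueSum {V : Type*} [Fintype V]
    (G₁ G₂ : SimpleGraph V) (V₁ V₂ : Set V)
    (hcover : V₁ ∪ V₂ = Set.univ)
    (hE₁ : ∀ i j, G₁.Adj i j → i ∈ V₁ ∧ j ∈ V₁)
    (hE₂ : ∀ i j, G₂.Adj i j → i ∈ V₂ ∧ j ∈ V₂)
    (hclique : ∀ i ∈ V₁ ∩ V₂, ∀ j ∈ V₁ ∩ V₂, i ≠ j → G₁.Adj i j ∧ G₂.Adj i j)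
    (r₁ r₂ : ℝ)
    (h₁ : ∃ (d : ℕ) (u : V → EuclideanSpace ℝ (Fin d)) (c : EuclideanSpace ℝ (Fin d)),
      IsUnitDistRep G₁ u ∧ ∀ i, ‖u i - c‖ ≤ r₁)
    (h₂ : ∃ (d : ℕ) (u : V → EuclideanSpace ℝ (Fin d)) (c : EuclideanSpace ℝ (Fin d)),
      IsUnitDistRep G₂ u ∧ ∀ i, ‖u i - c‖ ≤ r₂) :
    ∃ (d : ℕ) (u : V → EuclideanSpace ℝ (Fin d)) (c : EuclideanSpace ℝ (Fin d)),
      IsUnitDistRep (G₁ ⊔ G₂) u ∧ ∀ i, ‖u i - c‖ ≤ max r₁ r₂ := by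
  classical
  rcases isEmpty_or_nonempty V with hV | hV
  · exact aux_transfer _ _ (fun _ => 0) (fun i => hV.elim i) (fun i => hV.elim i)
  obtain ⟨d₁, u₁, c₁, hu₁, hc₁⟩ := h₁
  obtain ⟨d₂, u₂, c₂, hu₂, hc₂⟩ := h₂
  set r := max r₁ r₂ with hrdef
  have hr : 0 ≤ r :=
    (norm_nonneg _).trans ((hc₁ (Classical.arbitrary V)).trans (le_max_left _ _))
  by_cases hr2 : r ^ 2 < 1 / 2
  · obtain ⟨w₁, hn₁, hw₁⟩ := aux_hyper G₁ (fun i => u₁ i - c₁) r hr hr2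
      (fun i j h => by simpa using hu₁ i j h) (fun i => (hc₁ i).trans (le_max_left _ _))
    obtain ⟨w₂, hn₂, hw₂⟩ := aux_hyper G₂ (fun i => u₂ i - c₂) r hr hr2
      (fun i j h => by simpa using hu₂ i j h) (fun i => (hc₂ i).trans (le_max_right _ _))
    obtain ⟨L, hL⟩ := aux_glue (V₁ ∩ V₂) w₁ w₂ (by
      intro i hi j hj
      by_cases hij : i = j
      · subst hij; rw [hn₁, hn₂]
      · obtain ⟨h1, h2⟩ := hclique i hi j hj hij
        rw [hw₁ i j h1, hw₂ i j h2])
    let w : V → EuclideanSpace ℝ V := fun i => if i ∈ V₁ then L (w₁ i) else w₂ i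
    have hwV₁ : ∀ i ∈ V₁, w i = L (w₁ i) := fun i hi => by simp [w, hi]
    have hwV₂ : ∀ i ∈ V₂, w i = w₂ i := by
      intro i hi
      by_cases h : i ∈ V₁
      · rw [hwV₁ i h, hL i ⟨h, hi⟩]
      · simp [w, h]
    have hnw : ∀ i, ‖w i‖ ^ 2 = r ^ 2 := by
      intro i
      by_cases h : i ∈ V₁
      · rw [hwV₁ i h, L.norm_map, ← real_inner_self_eq_norm_sq, hn₁]
      · simp only [w, h, if_false]
        rw [← real_inner_self_eq_norm_sq, hn₂]
    refine aux_transfer _ _ w (fun i j h => ?_) (fun i => ?_)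
    · have hin : inner ℝ (w i) (w j) = r ^ 2 - 1 / 2 := by
        rcases h with h | h
        · rw [hwV₁ i (hE₁ i j h).1, hwV₁ j (hE₁ i j h).2, L.inner_map_map, hw₁ i j h]
        · rw [hwV₂ i (hE₂ i j h).1, hwV₂ j (hE₂ i j h).2, hw₂ i j h]
      have h1 := norm_sub_sq_real (w i) (w j)
      rw [hnw, hnw, hin] at h1
      have h2 : ‖w i - w j‖ ^ 2 = 1 := by rw [h1]; ring
      exact (pow_eq_one_iff_of_nonneg (norm_nonneg _) two_ne_zero).1 h2
    · exact ((sq_eq_sq₀ (norm_nonneg _) hr).1 (hnw i)).le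
  · push Not at hr2
    have hs : (√(1/2 : ℝ)) ^ 2 = 1 / 2 := Real.sq_sqrt (by norm_num)
    have hs0 : 0 ≤ √(1/2 : ℝ) := Real.sqrt_nonneg _
    refine aux_transfer _ _ (fun i => √(1/2 : ℝ) • EuclideanSpace.single i (1 : ℝ))
      (fun i j h => ?_) (fun i => ?_)
    · have hij := h.ne
      have h1 := norm_sub_sq_real
        (√(1/2 : ℝ) • EuclideanSpace.single i (1 : ℝ) : EuclideanSpace ℝ V)
        (√(1/2 : ℝ) • EuclideanSpace.single j (1 : ℝ))
      rw [norm_smul, norm_smul, inner_smul_left, inner_smul_right] at h1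
      simp only [EuclideanSpace.inner_single_left, EuclideanSpace.single_apply, if_neg hij,
        EuclideanSpace.norm_single, norm_one, mul_one, mul_zero, Real.norm_eq_abs, sq_abs,
        hs] at h1
      refine (pow_eq_one_iff_of_nonneg (norm_nonneg _) two_ne_zero).1 ?_
      rw [h1]; norm_num
    · rw [norm_smul]
      simp only [EuclideanSpace.norm_single, norm_one, mul_one, Real.norm_eq_abs,
        abs_of_nonneg hs0]
      exact (sq_le_sq₀ hs0 hr).1 (by rw [hs]; exact hr2)
end
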